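/- (Theorem 3.2, sparse combination, explicit-constant form.) Fix c ∈ (0,1), δ ∈ (0,1), L > 0, B > 0, and integers 1 ≤ s ≤ T, m ≥ 1, d ≥ 1. Let E be a real T × d matrix with largest singular value σ_max(E), and let f : ℝ^d → ℝ^T satisfy ‖f(x) − f(y)‖₁ ≤ L·‖x − y‖₂, have all coordinates in {0} ∪ [c,1], and map each Eᵀα to a probability vector on Fin T. Let U be a set of m new tokens, and for each u ∈ U let α^(u) ∈ ℝ^T satisfy ‖α^(u)‖₀ ≤ s, ‖α^(u)‖₂ ≤ B, and set q^(u) = f(Eᵀα^(u)). Suppose the dataset consists of N' ≥ N independent occurrences in which the new token is drawn uniformly from U and, conditioned on the new token being u, the successor symbol in Fin T is drawn from q^(u), independently across occurrences. For each u, let α̂^(u) be any minimizer, over the feasible sparse set {α : ‖α‖₀ ≤ s, ‖α‖₂ ≤ B, f(Eᵀα)_k ≥ c whenever q^(u)_k > 0}, of the empirical negative log-likelihood of the successor samples observed after u. If N ≥ 8m·log(2m/δ), then with probability at least 1 − δ, the risk R = max_{u ∈ U} D(q^(u)‖f(Eᵀα̂^(u))) satisfies, for every ε > 0, R ≤ ε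 + sqrt( (4·m·(log c)²/N) · ( s·log(36·B·T·L·σ_max(E)/(c·s·ε)) + log(4m/δ) ) ). -/

import Mathlib

open MeasureTheory ProbabilityTheory

/-- KL divergence between probability vectors on `Fin T` (finite value; the sum runs
over the support of the first argument). -/
noncomputable def KLdiv {T : ℕ} (p q : Fin T → ℝ) : ℝ :=
  ∑ k ∈ Finset.univ.filter fun k => 0 < p k, p k * Real.log (p k / q k)

/-- The set of `s`-sparse vectors in `ℝ^T` of Euclidean norm at most `B`. -/
def sparseBall (T s : ℕ) (B : ℝ) : Set (Fin T → ℝ) :=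
  {α | (Finset.univ.filter fun k => α k ≠ 0).card ≤ s ∧ Real.sqrt (∑ k, (α k) ^ 2) ≤ B}

open scoped ENNReal NNReal in
theorem aux_pack {F : Type*} [NormedAddCommGroup F] [NormedSpace ℝ F] [FiniteDimensional ℝ F]
    (B η : ℝ) (hη : 0 < η) (hηB : η ≤ B) (P : Finset F) (hP : ∀ x ∈ P, ‖x‖ ≤ B)
    (hsep : ∀ x ∈ P, ∀ y ∈ P, x ≠ y → η ≤ dist x y) :
    (P.card : ℝ) ≤ (3 * B / η) ^ Module.finrank ℝ F := by
  borelize F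
  let μ : Measure F := Measure.addHaar
  have hδ : 0 < η / 2 := by positivity
  have hρ : 0 < B + η / 2 := by linarith
  have D : Set.Pairwise (P : Set F) (Function.onFun Disjoint fun c => Metric.ball (c : F) (η / 2)) := by
    rintro c hc d hd hcd
    apply Metric.ball_disjoint_ball
    have := hsep c hc d hd hcd
    linarith
  have hsub : (⋃ c ∈ P, Metric.ball (c : F) (η / 2)) ⊆ Metric.ball (0 : F) (B + η / 2) := by
    refine Set.iUnion₂_subset fun x hx => ?_
    apply Metric.ball_subset_ball'
    rw [dist_zero_right]
    linarith [hP x hx]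
  have I : (P.card : ℝ≥0∞) * ENNReal.ofReal ((η / 2) ^ Module.finrank ℝ F) * μ (Metric.ball 0 1) ≤
      ENNReal.ofReal ((B + η / 2) ^ Module.finrank ℝ F) * μ (Metric.ball 0 1) :=
    calc
      _ = μ (⋃ c ∈ P, Metric.ball (c : F) (η / 2)) := by
        rw [measure_biUnion_finset D fun c _ => measurableSet_ball]
        simp only [μ.addHaar_ball_of_pos _ hδ]
        simp only [Finset.sum_const, nsmul_eq_mul, mul_assoc]
      _ ≤ μ (Metric.ball (0 : F) (B + η / 2)) := measure_mono hsub
      _ = _ := by simp only [μ.addHaar_ball_of_pos _ hρ]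
  have J := (ENNReal.mul_le_mul_iff_left (Metric.measure_ball_pos _ _ zero_lt_one).ne'
    measure_ball_lt_top.ne).1 I
  have K := ENNReal.toReal_le_of_le_ofReal (pow_nonneg hρ.le _) J
  rw [ENNReal.toReal_mul, ENNReal.toReal_natCast, ENNReal.toReal_ofReal (by positivity)] at K
  rw [← le_div_iff₀ (by positivity), ← div_pow] at K
  refine K.trans ?_
  apply pow_le_pow_left₀ (by positivity)
  rw [div_le_div_iff₀ hδ hη]
  nlinarith

theorem aux_net {F : Type*} [NormedAddCommGroup F] [NormedSpace ℝ F] [FiniteDimensional ℝ F]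
    (B η : ℝ) (hη : 0 < η) (hηB : η ≤ B) (A : Set F) (hA : ∀ x ∈ A, ‖x‖ ≤ B) :
    ∃ P : Finset F, (∀ x ∈ P, x ∈ A) ∧ (P.card : ℝ) ≤ (3 * B / η) ^ Module.finrank ℝ F ∧
      ∀ a ∈ A, ∃ b ∈ P, dist a b ≤ η := by
  classical
  let Q : ℕ → Prop := fun n => ∃ P : Finset F, (∀ x ∈ P, x ∈ A) ∧
    (∀ x ∈ P, ∀ y ∈ P, x ≠ y → η ≤ dist x y) ∧ P.card = n
  have hbd : ∀ n, Q n → n ≤ ⌊(3 * B / η) ^ Module.finrank ℝ F⌋₊ := by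
    rintro n ⟨P, h1, h2, rfl⟩
    exact Nat.le_floor (aux_pack B η hη hηB P (fun x hx => hA x (h1 x hx)) h2)
  have h0 : Q 0 := ⟨∅, by simp, by simp, by simp⟩
  have hspec := Nat.findGreatest_spec (P := Q)
    (Nat.zero_le ⌊(3 * B / η) ^ Module.finrank ℝ F⌋₊) h0
  set n := Nat.findGreatest Q ⌊(3 * B / η) ^ Module.finrank ℝ F⌋₊ with hn
  obtain ⟨P, h1, h2, h3⟩ := hspec
  refine ⟨P, h1, aux_pack B η hη hηB P (fun x hx => hA x (h1 x hx)) h2, ?_⟩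
  intro a ha
  by_contra! hcon
  have haP : a ∉ P := by
    intro h
    have := hcon a h
    simp at this
    linarith
  have hQ : Q (n + 1) := by
    refine ⟨insert a P, ?_, ?_, ?_⟩
    · intro x hx
      rcases Finset.mem_insert.1 hx with rfl | hx
      · exact ha
      · exact h1 x hx
    · intro x hx y hy hxy
      rcases Finset.mem_insert.1 hx with rfl | hx2
      · rcases Finset.mem_insert.1 hy with rfl | hy
        · exact absurd rfl hxy
        · exact (hcon y hy).le
      · rcases Finset.mem_insert.1 hy with rfl | hy
        · rw [dist_comm]; exact (hcon x hx2).le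
        · exact h2 x hx2 y hy hxy
    · rw [Finset.card_insert_of_notMem haP, h3]
  have := Nat.le_findGreatest (hbd _ hQ) hQ
  omega

theorem aux_choose (T s : ℕ) (hs : 1 ≤ s) : (T.choose s : ℝ) ≤ (3 * T / s) ^ s := by
  have h1 : (T.choose s : ℝ) ≤ (T : ℝ) ^ s / s.factorial := Nat.choose_le_pow_div s T
  have h2 := Real.pow_div_factorial_le_exp (x := (s : ℝ)) (by positivity) s
  have h3 : Real.exp s ≤ 3 ^ s := by
    rw [← Real.exp_one_pow]
    gcongr
    exact (Real.exp_one_lt_d9.trans (by norm_num)).le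
  have hs' : (0 : ℝ) < s := by exact_mod_cast hs
  refine h1.trans ?_
  have h4 := h2.trans h3
  have hf : (0 : ℝ) < s.factorial := by exact_mod_cast s.factorial_pos
  rw [div_le_iff₀ hf] at h4
  rw [div_pow, mul_pow, div_le_div_iff₀ hf (by positivity)]
  have : (0 : ℝ) ≤ (T : ℝ) ^ s := by positivity
  nlinarith

theorem aux_sparse_net (T s : ℕ) (hs1 : 1 ≤ s) (hsT : s ≤ T) (B η : ℝ) (hη : 0 < η) (hηB : η ≤ B)
    (A : Set (Fin T → ℝ)) (hA : A ⊆ sparseBall T s B) :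
    ∃ P : Finset (Fin T → ℝ), (∀ x ∈ P, x ∈ A) ∧ (P.card : ℝ) ≤ (9 * B * T / (s * η)) ^ s ∧
      ∀ a ∈ A, ∃ b ∈ P, Real.sqrt (∑ k, (a k - b k) ^ 2) ≤ η := by
  classical
  have key : ∀ S : Finset (Fin T), S.card = s → ∃ P : Finset (Fin T → ℝ), (∀ x ∈ P, x ∈ A) ∧
      (P.card : ℝ) ≤ (3 * B / η) ^ s ∧
      ∀ a ∈ A, (∀ k, a k ≠ 0 → k ∈ S) → ∃ b ∈ P, Real.sqrt (∑ k, (a k - b k) ^ 2) ≤ η := by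
    intro S hS
    let r : (Fin T → ℝ) → EuclideanSpace ℝ S := fun a => WithLp.toLp 2 (fun i => a i)
    let A' : Set (Fin T → ℝ) := {a | a ∈ A ∧ ∀ k, a k ≠ 0 → k ∈ S}
    obtain ⟨P, h1, h2, h3⟩ := aux_net B η hη hηB (r '' A') (by
      rintro _ ⟨a, ⟨ha, haS⟩, rfl⟩
      refine le_trans ?_ (hA ha).2
      rw [EuclideanSpace.norm_eq]
      apply Real.sqrt_le_sqrt
      simp only [r, Real.norm_eq_abs, sq_abs]
      rw [Finset.sum_coe_sort S (fun k => a k ^ 2)]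
      exact Finset.sum_le_sum_of_subset_of_nonneg (Finset.subset_univ _) (fun _ _ _ => sq_nonneg _))
    choose! g hg using h1
    refine ⟨P.image g, ?_, ?_, ?_⟩
    · intro x hx
      obtain ⟨y, hy, rfl⟩ := Finset.mem_image.1 hx
      exact (hg y hy).1.1
    · have : Module.finrank ℝ (EuclideanSpace ℝ S) = s := by simp [hS]
      rw [this] at h2
      refine le_trans ?_ h2
      exact_mod_cast Finset.card_image_le
    · intro a ha haS
      obtain ⟨b, hb, hab⟩ := h3 (r a) ⟨a, ⟨ha, haS⟩, rfl⟩
      refine ⟨g b, Finset.mem_image_of_mem _ hb, ?_⟩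
      refine le_trans (le_of_eq ?_) hab
      have hgb : dist (r a) b = dist (r a) (r (g b)) := by rw [(hg b hb).2]
      rw [hgb, EuclideanSpace.dist_eq]
      congr 1
      simp only [r, Real.dist_eq, sq_abs]
      rw [Finset.sum_coe_sort S (fun k => (a k - g b k) ^ 2)]
      symm
      apply Finset.sum_subset (Finset.subset_univ _)
      intro k _ hk
      have e1 : a k = 0 := by
        by_contra h; exact hk (haS k h)
      have e2 : g b k = 0 := by
        by_contra h; exact hk ((hg b hb).1.2 k h)
      simp [e1, e2]
  choose! P hP1 hP2 hP3 using key
  refine ⟨(Finset.powersetCard s Finset.univ).biUnion P, ?_, ?_, ?_⟩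
  · intro x hx
    obtain ⟨S, hS, hx⟩ := Finset.mem_biUnion.1 hx
    exact hP1 S (Finset.mem_powersetCard.1 hS).2 x hx
  · have hs' : (0 : ℝ) < s := by exact_mod_cast hs1
    calc (((Finset.powersetCard s Finset.univ).biUnion P).card : ℝ)
        ≤ ∑ S ∈ Finset.powersetCard s (Finset.univ : Finset (Fin T)), ((P S).card : ℝ) := by
          exact_mod_cast Finset.card_biUnion_le
      _ ≤ ∑ S ∈ Finset.powersetCard s (Finset.univ : Finset (Fin T)), (3 * B / η) ^ s :=
          Finset.sum_le_sum fun S hS => hP2 S (Finset.mem_powersetCard.1 hS).2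
      _ = (T.choose s : ℝ) * (3 * B / η) ^ s := by simp
      _ ≤ (3 * T / s) ^ s * (3 * B / η) ^ s := by
          have : 0 < B := hη.trans_le hηB
          gcongr
          exact aux_choose T s hs1
      _ = _ := by
          rw [← mul_pow]
          congr 1
          field_simp
          ring
  · intro a ha
    obtain ⟨S, hS1, hS2⟩ := Finset.exists_superset_card_eq (hA ha).1 (by simpa using hsT)
    obtain ⟨b, hb, hab⟩ := hP3 S hS2 a ha (fun k hk => hS1 (by simp [hk]))
    exact ⟨b, Finset.mem_biUnion.2 ⟨S, Finset.mem_powersetCard.2 ⟨Finset.subset_univ _, hS2⟩, hb⟩, hab⟩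

theorem aux_hoeffding {T : ℕ} (q h : Fin T → ℝ) (hq : ∀ k, 0 ≤ q k) (hq1 : ∑ k, q k = 1)
    (R : ℝ) (hh : ∀ k, h k ∈ Set.Icc 0 R) (l : ℝ) :
    ∑ k, q k * Real.exp (l * (h k - ∑ i, q i * h i)) ≤ Real.exp (l ^ 2 * R ^ 2 / 8) := by
  let p : PMF (Fin T) := PMF.ofFintype (fun k => ENNReal.ofReal (q k)) (by
    rw [← ENNReal.ofReal_sum_of_nonneg (fun k _ => hq k), hq1, ENNReal.ofReal_one])
  have hp : ∀ k, (p k).toReal = q k := fun k => by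
    simp [p, PMF.ofFintype_apply, hq k]
  have H := (hasSubgaussianMGF_of_mem_Icc (μ := p.toMeasure) (X := h) (a := 0) (b := R)
    (measurable_of_finite h).aemeasurable (Filter.Eventually.of_forall hh)).mgf_le l
  rw [mgf, PMF.integral_eq_sum, PMF.integral_eq_sum] at H
  simp only [hp, smul_eq_mul] at H
  refine H.trans (le_of_eq ?_)
  congr 1
  simp [div_pow, sq_abs]
  ring

theorem aux_chernoff {Ω S : Type*} [MeasurableSpace Ω] (μ : Measure Ω) [IsProbabilityMeasure μ]
    [Fintype S] [MeasurableSpace S] [MeasurableSingletonClass S] (n : ℕ) (X : Fin n → Ω → S)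
    (hX : ∀ j, Measurable (X j)) (hind : iIndepFun X μ) (p : S → ℝ) (hp : ∀ a, 0 ≤ p a)
    (hlaw : ∀ j a, μ {ω | X j ω = a} = ENNReal.ofReal (p a)) (ψ : S → ℝ) (κ : ℝ)
    (hκ : ∑ a, p a * Real.exp (ψ a) ≤ Real.exp κ) (x : ℝ) :
    μ.real {ω | x ≤ ∑ j, ψ (X j ω)} ≤ Real.exp (n * κ - x) := by
  have hψ : Measurable ψ := measurable_of_finite ψ
  have hind' : iIndepFun (fun j ω => ψ (X j ω)) μ := hind.comp (fun _ => ψ) (fun _ => hψ)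
  have hm : ∀ j, mgf (fun ω => ψ (X j ω)) μ 1 ≤ Real.exp κ := by
    intro j
    refine le_trans (le_of_eq ?_) hκ
    rw [mgf]
    have : ∫ ω, Real.exp (1 * ψ (X j ω)) ∂μ = ∫ a, Real.exp (ψ a) ∂(μ.map (X j)) := by
      rw [integral_map (hX j).aemeasurable (measurable_of_finite _).aestronglyMeasurable]
      simp
    rw [this]
    have : IsProbabilityMeasure (μ.map (X j)) := Measure.isProbabilityMeasure_map (hX j).aemeasurable
    rw [integral_fintype .of_finite]
    refine Finset.sum_congr rfl fun a _ => ?_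
    rw [measureReal_def, Measure.map_apply (hX j) (measurableSet_singleton a)]
    have : X j ⁻¹' {a} = {ω | X j ω = a} := rfl
    rw [this, hlaw, ENNReal.toReal_ofReal (hp a), smul_eq_mul]
  have hb : ∃ C, ∀ ω, |∑ j, ψ (X j ω)| ≤ C := by
    refine ⟨∑ j : Fin n, ∑ a, |ψ a|, fun ω => ?_⟩
    refine (Finset.abs_sum_le_sum_abs _ _).trans (Finset.sum_le_sum fun j _ => ?_)
    exact Finset.single_le_sum (f := fun a => |ψ a|) (fun _ _ => abs_nonneg _) (Finset.mem_univ _)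
  obtain ⟨C, hC⟩ := hb
  have hms : Measurable fun ω => ∑ j, ψ (X j ω) :=
    Finset.measurable_sum _ fun j _ => hψ.comp (hX j)
  have hmain := measure_ge_le_exp_mul_mgf (μ := μ) (X := fun ω => ∑ j, ψ (X j ω)) (t := 1) x
    zero_le_one (by
      refine Integrable.of_bound (C := Real.exp C)
        (Real.measurable_exp.comp (hms.const_mul 1)).aestronglyMeasurable (Filter.Eventually.of_forall fun ω => ?_)
      rw [Real.norm_eq_abs, Real.abs_exp, one_mul]
      exact Real.exp_le_exp.2 ((le_abs_self _).trans (hC ω)))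
  refine hmain.trans ?_
  have e : (fun ω => ∑ j, ψ (X j ω)) = ∑ j, fun ω => ψ (X j ω) := by
    ext ω; simp
  rw [e, hind'.mgf_sum (fun j => hψ.comp (hX j))]
  have : ∏ j, mgf (fun ω => ψ (X j ω)) μ 1 ≤ ∏ j : Fin n, Real.exp κ :=
    Finset.prod_le_prod (fun _ _ => mgf_nonneg) (fun j _ => hm j)
  rw [Finset.prod_const, Finset.card_univ, Fintype.card_fin, ← Real.exp_nat_mul] at this
  rw [sub_eq_neg_add, Real.exp_add]
  rw [neg_one_mul]
  gcongr

theorem aux_count {Ω U : Type*} [MeasurableSpace Ω] (μ : Measure Ω) [IsProbabilityMeasure μ]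
    [Fintype U] [DecidableEq U] [MeasurableSpace U] [MeasurableSingletonClass U] {T : ℕ}
    (m : ℕ) (hm : 1 ≤ m) (hcard : Fintype.card U = m) (q : U → Fin T → ℝ)
    (hq : ∀ u k, 0 ≤ q u k) (hq1 : ∀ u, ∑ k, q u k = 1)
    (n : ℕ) (tok : Fin n → Ω → U) (suc : Fin n → Ω → Fin T)
    (hmeas : ∀ j, Measurable fun ω => (tok j ω, suc j ω))
    (hindep : iIndepFun (fun j ω => (tok j ω, suc j ω)) μ)
    (hjoint : ∀ (j : Fin n) (u : U) (k : Fin T),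
      μ {ω | tok j ω = u ∧ suc j ω = k} = ENNReal.ofReal ((1 / m) * q u k)) (u : U) :
    μ.real {ω | ((Finset.univ.filter fun j => tok j ω = u).card : ℝ) ≤ n / (2 * m)}
      ≤ Real.exp (-(n / (8 * m))) := by
  have hm' : (0 : ℝ) < m := by exact_mod_cast hm
  have hlog : Real.log 2 ≤ 3 / 4 := (Real.log_two_lt_d9.trans (by norm_num)).le
  have hlog0 : 0 < Real.log 2 := Real.log_pos (by norm_num)
  have H := aux_chernoff μ n (fun j ω => (tok j ω, suc j ω)) hmeas hindep
    (fun a => (1 / m) * q a.1 a.2) (fun a => mul_nonneg (by positivity) (hq _ _))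
    (fun j a => by
      rw [← hjoint j a.1 a.2]
      congr 1
      ext ω
      simp [Prod.ext_iff])
    (fun a => if a.1 = u then -Real.log 2 else 0) (-(1 / (2 * m))) (by
      rw [Fintype.sum_prod_type]
      have : ∀ v : U, ∑ k, (1 / m) * q v k * Real.exp (if v = u then -Real.log 2 else 0)
          = (1 / m) + (if v = u then -(1 / (2 * m : ℝ)) else 0) := by
        intro v
        rw [← Finset.sum_mul, ← Finset.mul_sum, hq1]
        split_ifs
        · rw [Real.exp_neg, Real.exp_log (by norm_num)]
          field_simp; ring
        · simp
      simp only [this]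
      rw [Finset.sum_add_distrib, Finset.sum_ite_eq']
      simp only [Finset.sum_const, Finset.card_univ, hcard, Finset.mem_univ, if_true, nsmul_eq_mul]
      rw [mul_one_div_cancel hm'.ne']
      linarith [Real.add_one_le_exp (-(1 / (2 * m : ℝ)))])
    (-Real.log 2 * (n / (2 * m)))
  refine le_trans (measureReal_mono ?_) (H.trans ?_)
  · intro ω hω
    simp only [Set.mem_ofPred_eq] at hω ⊢
    rw [← Finset.sum_filter, Finset.sum_const, nsmul_eq_mul]
    nlinarith
  · apply Real.exp_le_exp.2
    have e : (n : ℝ) * -(1 / (2 * m)) - -Real.log 2 * (n / (2 * m))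
      = (n / m) * (Real.log 2 / 2 - 1 / 2) := by field_simp; ring
    have e2 : -((n : ℝ) / (8 * m)) = (n / m) * (-1 / 8) := by field_simp
    rw [e, e2]
    apply mul_le_mul_of_nonneg_left _ (by positivity)
    linarith

theorem aux_dev {Ω U : Type*} [MeasurableSpace Ω] (μ : Measure Ω) [IsProbabilityMeasure μ]
    [Fintype U] [DecidableEq U] [MeasurableSpace U] [MeasurableSingletonClass U] {T : ℕ}
    (m : ℕ) (hm : 1 ≤ m) (hcard : Fintype.card U = m) (q : U → Fin T → ℝ)
    (hq : ∀ u k, 0 ≤ q u k) (hq1 : ∀ u, ∑ k, q u k = 1)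
    (n : ℕ) (tok : Fin n → Ω → U) (suc : Fin n → Ω → Fin T)
    (hmeas : ∀ j, Measurable fun ω => (tok j ω, suc j ω))
    (hindep : iIndepFun (fun j ω => (tok j ω, suc j ω)) μ)
    (hjoint : ∀ (j : Fin n) (u : U) (k : Fin T),
      μ {ω | tok j ω = u ∧ suc j ω = k} = ENNReal.ofReal ((1 / m) * q u k)) (u : U)
    (h : Fin T → ℝ) (R : ℝ) (hR : 0 < R) (hh : ∀ k, h k ∈ Set.Icc 0 R) (n0 t : ℝ)
    (sg : ℝ) (hsg : sg ^ 2 = 1) (ht : 0 ≤ t) :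
    μ.real {ω | n0 ≤ ((Finset.univ.filter fun j => tok j ω = u).card : ℝ) ∧
        ((Finset.univ.filter fun j => tok j ω = u).card : ℝ) * t ≤
        sg * ∑ j ∈ Finset.univ.filter (fun j => tok j ω = u), (h (suc j ω) - ∑ k, q u k * h k)}
      ≤ Real.exp (-(2 * n0 * t ^ 2 / R ^ 2)) := by
  have hm' : (0 : ℝ) < m := by exact_mod_cast hm
  set l : ℝ := sg * (4 * t / R ^ 2) with hl
  have H := aux_chernoff μ n (fun j ω => (tok j ω, suc j ω)) hmeas hindep
    (fun a => (1 / m) * q a.1 a.2) (fun a => mul_nonneg (by positivity) (hq _ _))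
    (fun j a => by
      rw [← hjoint j a.1 a.2]
      congr 1
      ext ω
      simp [Prod.ext_iff])
    (fun a => if a.1 = u then l * (h a.2 - ∑ k, q u k * h k) - l ^ 2 * R ^ 2 / 8 else 0) 0 (by
      rw [Fintype.sum_prod_type]
      have : ∀ v : U, ∑ k, (1 / m) * q v k * Real.exp
          (if v = u then l * (h k - ∑ k, q u k * h k) - l ^ 2 * R ^ 2 / 8 else 0)
          ≤ (1 / m) := by
        intro v
        split_ifs with hv
        · subst hv
          have h1 := aux_hoeffding (q v) h (hq v) (hq1 v) R hh l
          have h2 : ∑ k, (1 / (m : ℝ)) * q v k * Real.exp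
              (l * (h k - ∑ k, q v k * h k) - l ^ 2 * R ^ 2 / 8)
              = (1 / m) * ((∑ k, q v k * Real.exp (l * (h k - ∑ i, q v i * h i)))
                / Real.exp (l ^ 2 * R ^ 2 / 8)) := by
            rw [Finset.sum_div, Finset.mul_sum]
            refine Finset.sum_congr rfl fun k _ => ?_
            rw [Real.exp_sub]
            ring
          rw [h2]
          have h3 := (div_le_one (Real.exp_pos (l ^ 2 * R ^ 2 / 8))).2 h1
          have : (0 : ℝ) ≤ 1 / m := by positivity
          nlinarith
        · rw [← Finset.sum_mul, ← Finset.mul_sum, hq1]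
          simp
      refine (Finset.sum_le_sum fun v _ => this v).trans ?_
      simp only [Finset.sum_const, Finset.card_univ, hcard, nsmul_eq_mul]
      rw [mul_one_div_cancel hm'.ne']
      simp)
    (2 * n0 * t ^ 2 / R ^ 2)
  refine le_trans (measureReal_mono ?_) (H.trans ?_)
  · rintro ω ⟨h1, h2⟩
    simp only [Set.mem_ofPred_eq]
    rw [← Finset.sum_filter, Finset.sum_sub_distrib, Finset.sum_const, nsmul_eq_mul, ← Finset.mul_sum]
    set D := ∑ j ∈ Finset.univ.filter (fun j => tok j ω = u), (h (suc j ω) - ∑ k, q u k * h k)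
    set n1 : ℝ := ((Finset.univ.filter fun j => tok j ω = u).card : ℝ)
    have e1 : l * D - n1 * (l ^ 2 * R ^ 2 / 8)
        = (4 * t / R ^ 2) * (sg * D) - n1 * (2 * t ^ 2 / R ^ 2) := by
      have : l ^ 2 = 16 * t ^ 2 / R ^ 4 := by
        rw [hl, mul_pow, hsg]; field_simp; ring
      rw [this, hl]; field_simp; ring
    rw [e1]
    have h3 := mul_le_mul_of_nonneg_left h2 (show 0 ≤ 4 * t / R ^ 2 by positivity)
    have h4 := mul_le_mul_of_nonneg_right h1 (show 0 ≤ 2 * t ^ 2 / R ^ 2 by positivity)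
    have e2 : 4 * t / R ^ 2 * (n1 * t) = 2 * (n1 * (2 * t ^ 2 / R ^ 2)) := by ring
    have e3 : 2 * n0 * t ^ 2 / R ^ 2 = n0 * (2 * t ^ 2 / R ^ 2) := by ring
    linarith
  · simp

theorem aux_log {c x y : ℝ} (hc : 0 < c) (hx : c ≤ x) (hy : c ≤ y) :
    Real.log x - Real.log y ≤ |x - y| / c := by
  have hx' := hc.trans_le hx
  have hy' := hc.trans_le hy
  rw [← Real.log_div hx'.ne' hy'.ne']
  refine (Real.log_le_sub_one_of_pos (by positivity)).trans ?_
  have : x / y - 1 = (x - y) / y := by field_simp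
  rw [this]
  calc (x - y) / y ≤ |x - y| / y := by gcongr; exact le_abs_self _
    _ ≤ _ := by gcongr

theorem aux_KL {T : ℕ} (q p : Fin T → ℝ) (hq : ∀ k, 0 ≤ q k) (hp : ∀ k, 0 < q k → 0 < p k) :
    KLdiv q p = (∑ k, q k * (-Real.log (p k))) - ∑ k, q k * (-Real.log (q k)) := by
  rw [KLdiv, Finset.sum_filter, ← Finset.sum_sub_distrib]
  refine Finset.sum_congr rfl fun k _ => ?_
  split_ifs with h
  · rw [Real.log_div h.ne' (hp k h).ne']; ring
  · have : q k = 0 := le_antisymm (not_lt.1 h) (hq k)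
    simp [this]

set_option maxHeartbeats 2000000 in
theorem aux_core {Ω U : Type*} [MeasurableSpace Ω] (μ : Measure Ω) [IsProbabilityMeasure μ]
    [Fintype U] [DecidableEq U] [MeasurableSpace U] [MeasurableSingletonClass U] {T : ℕ}
    (c : ℝ) (hc0 : 0 < c) (hc1 : c < 1) (δ : ℝ) (hδ0 : 0 < δ) (hδ1 : δ < 1)
    (L : ℝ) (hL : 0 < L) (σ : ℝ) (hσ : 0 < σ) (B : ℝ) (hB : 0 < B)
    (s : ℕ) (hs1 : 1 ≤ s) (hsT : s ≤ T)
    (F : (Fin T → ℝ) → Fin T → ℝ)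
    (hLip : ∀ a b k, |F a k - F b k| ≤ L * σ * Real.sqrt (∑ j, (a j - b j) ^ 2))
    (hrange : ∀ x k, F x k = 0 ∨ (c ≤ F x k ∧ F x k ≤ 1))
    (hprob : ∀ a, ∑ k, F a k = 1)
    (m : ℕ) (hm : 1 ≤ m) (hcard : Fintype.card U = m)
    (α0 : U → Fin T → ℝ) (hα0 : ∀ u, α0 u ∈ sparseBall T s B)
    (N N' : ℕ) (hNN' : N ≤ N')
    (tok : Fin N' → Ω → U) (suc : Fin N' → Ω → Fin T)
    (hmeas : ∀ j, Measurable fun ω => (tok j ω, suc j ω))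
    (hindep : iIndepFun (fun j ω => (tok j ω, suc j ω)) μ)
    (hjoint : ∀ (j : Fin N') (u : U) (k : Fin T),
      μ {ω | tok j ω = u ∧ suc j ω = k} = ENNReal.ofReal ((1 / m) * F (α0 u) k))
    (αhat : U → Ω → Fin T → ℝ)
    (hαhat_mem : ∀ (u : U) (ω : Ω), αhat u ω ∈ {a ∈ sparseBall T s B |
      ∀ k, 0 < F (α0 u) k → c ≤ F a k})
    (hαhat_min : ∀ (u : U) (ω : Ω), ∀ α ∈ {a ∈ sparseBall T s B |
        ∀ k, 0 < F (α0 u) k → c ≤ F a k},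
      ∑ j ∈ Finset.univ.filter fun j => tok j ω = u, -Real.log (F (αhat u ω) (suc j ω))
        ≤ ∑ j ∈ Finset.univ.filter fun j => tok j ω = u, -Real.log (F α (suc j ω)))
    (hN : 8 * m * Real.log (2 * m / δ) ≤ N)
    (ε : ℝ) (hε : 0 < ε) (hε1 : ε ≤ 2 * L * σ * B / c) :
    μ.real {ω | ¬ ∀ u : U, KLdiv (F (α0 u)) (F (αhat u ω))
          ≤ ε + Real.sqrt ((4 * m * (Real.log c) ^ 2 / N)
              * (s * Real.log (36 * B * T * L * σ / (c * s * ε)) + Real.log (4 * m / δ)))} ≤ δ := by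
  classical
  have hm' : (1 : ℝ) ≤ m := by exact_mod_cast hm
  have hs' : (1 : ℝ) ≤ s := by exact_mod_cast hs1
  have hsT' : (s : ℝ) ≤ T := by exact_mod_cast hsT
  have hT' : (1 : ℝ) ≤ T := hs'.trans hsT'
  have hNN'' : (N : ℝ) ≤ N' := by exact_mod_cast hNN'
  have hlog2 : 0 < Real.log (2 * m / δ) := by
    apply Real.log_pos
    rw [lt_div_iff₀ hδ0]; linarith
  have hNpos : (0 : ℝ) < N := lt_of_lt_of_le (by positivity) hN
  set R : ℝ := -Real.log c with hRdef
  have hR : 0 < R := by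
    have := Real.log_neg hc0 hc1
    linarith
  have hR2 : Real.log c ^ 2 = R ^ 2 := by rw [hRdef]; ring
  rw [hR2]
  -- the net
  set η : ℝ := c * ε / (2 * L * σ) with hη
  have hηpos : 0 < η := by positivity
  have hηB : η ≤ B := by
    rw [hη, div_le_iff₀ (by positivity)]
    rw [le_div_iff₀ hc0] at hε1
    linarith
  have hLση : L * σ * η / c = ε / 2 := by rw [hη]; field_simp
  set W : ℝ := 36 * B * T * L * σ / (c * s * ε) with hW
  have hW1 : 1 ≤ W := by
    rw [hW, le_div_iff₀ (by positivity)]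
    rw [le_div_iff₀ hc0] at hε1
    have h1 : c * s * ε ≤ s * (2 * L * σ * B) := by nlinarith
    have h2 : s * (2 * L * σ * B) ≤ T * (2 * L * σ * B) :=
      mul_le_mul_of_nonneg_right hsT' (by positivity)
    have h3 : 0 < T * L * σ * B := by positivity
    nlinarith
  have hWpos : 0 < W := by linarith
  let feas : U → Set (Fin T → ℝ) := fun u => {a ∈ sparseBall T s B |
      ∀ k, 0 < F (α0 u) k → c ≤ F a k}
  have hnet : ∀ u, ∃ P : Finset (Fin T → ℝ), (∀ x ∈ P, x ∈ feas u) ∧ (P.card : ℝ) ≤ W ^ s ∧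
      ∀ a ∈ feas u, ∃ b ∈ P, Real.sqrt (∑ k, (a k - b k) ^ 2) ≤ η := by
    intro u
    obtain ⟨P, h1, h2, h3⟩ := aux_sparse_net T s hs1 hsT B η hηpos hηB (feas u) (fun a ha => ha.1)
    refine ⟨P, h1, h2.trans ?_, h3⟩
    apply pow_le_pow_left₀ (by positivity)
    have : W = 2 * (9 * B * T / (s * η)) := by
      rw [hW, hη]; field_simp; norm_num
    rw [this]
    have : 0 ≤ 9 * B * T / (s * η) := by positivity
    linarith
  choose P hP1 hP2 hP3 using hnet
  -- basic facts
  have hF0 : ∀ a k, 0 ≤ F a k := by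
    intro a k
    rcases hrange a k with h | h
    · exact h.ge
    · exact hc0.le.trans h.1
  have hFc : ∀ a k, 0 < F a k → c ≤ F a k := by
    intro a k hk
    rcases hrange a k with h | h
    · exact absurd h hk.ne'
    · exact h.1
  have hloss : ∀ a k, -Real.log (F a k) ∈ Set.Icc 0 R := by
    intro a k
    rcases hrange a k with h | h
    · rw [h]; simp [hR.le]
    · constructor
      · have := Real.log_nonpos (hF0 a k) h.2
        linarith
      · have := Real.log_le_log hc0 h.1
        rw [hRdef]; linarith
  -- deviation level
  set Q : ℝ := s * Real.log W + Real.log (4 * m / δ) with hQ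
  have hQ0 : 0 ≤ Q := by
    have h1 := Real.log_nonneg hW1
    have h2 : 0 ≤ Real.log (4 * m / δ) := by
      apply Real.log_nonneg
      rw [le_div_iff₀ hδ0]; linarith
    positivity
  set t : ℝ := Real.sqrt (m * R ^ 2 / N * Q) with ht
  have ht0 : 0 ≤ t := Real.sqrt_nonneg _
  have ht2 : t ^ 2 = m * R ^ 2 / N * Q := Real.sq_sqrt (by positivity)
  have h2t : Real.sqrt (4 * m * R ^ 2 / N * Q) = 2 * t := by
    have : 4 * m * R ^ 2 / N * Q = 2 ^ 2 * (m * R ^ 2 / N * Q) := by ring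
    rw [this, Real.sqrt_mul (by positivity), Real.sqrt_sq (by norm_num)]
  rw [h2t]
  set n0 : ℝ := N' / (2 * m) with hn0
  have hn0pos : 0 < n0 := by
    have : (0 : ℝ) < N' := hNpos.trans_le hNN''
    positivity
  have hexp : Real.exp (-(2 * n0 * t ^ 2 / R ^ 2)) ≤ δ / (4 * m * W ^ s) := by
    have h1 : Q ≤ 2 * n0 * t ^ 2 / R ^ 2 := by
      have : 2 * n0 * t ^ 2 / R ^ 2 = (N' / N) * Q := by
        rw [ht2, hn0]; field_simp
      rw [this]
      have h2 : (1 : ℝ) ≤ N' / N := by rw [le_div_iff₀ hNpos]; linarith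
      nlinarith
    refine (Real.exp_le_exp.2 (neg_le_neg h1)).trans (le_of_eq ?_)
    rw [hQ, Real.exp_neg, Real.exp_add, Real.exp_log (by positivity), Real.exp_nat_mul,
      Real.exp_log hWpos]
    field_simp
  -- bad events
  let cnt : U → Ω → ℝ := fun u ω => ((Finset.univ.filter fun j => tok j ω = u).card : ℝ)
  let pop : U → (Fin T → ℝ) → ℝ := fun u a => ∑ k, F (α0 u) k * (-Real.log (F a k))
  let emp : U → (Fin T → ℝ) → Ω → ℝ := fun u a ω =>
    ∑ j ∈ Finset.univ.filter (fun j => tok j ω = u), -Real.log (F a (suc j ω))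
  let D : ℝ → U → (Fin T → ℝ) → Set Ω := fun sg u a => {ω | n0 ≤ cnt u ω ∧ cnt u ω * t ≤
        sg * ∑ j ∈ Finset.univ.filter (fun j => tok j ω = u),
          (-Real.log (F a (suc j ω)) - pop u a)}
  have hD : ∀ sg u a, sg ^ 2 = 1 → μ.real (D sg u a) ≤ δ / (4 * m * W ^ s) := by
    intro sg u a hsg
    exact (aux_dev μ m hm hcard (fun u => F (α0 u)) (fun u => hF0 _) (fun u => hprob _) N' tok suc
      hmeas hindep hjoint u (fun k => -Real.log (F a k)) R hR (hloss a) n0 t sg hsg ht0).trans hexp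
  let C : U → Set Ω := fun u => {ω | cnt u ω ≤ n0}
  have hC : ∀ u, μ.real (C u) ≤ δ / (2 * m) := by
    intro u
    refine (aux_count μ m hm hcard (fun u => F (α0 u)) (fun u => hF0 _) (fun u => hprob _) N' tok suc
      hmeas hindep hjoint u).trans ?_
    have : Real.log (2 * m / δ) ≤ N' / (8 * m) := by
      rw [le_div_iff₀ (by positivity)]; linarith
    refine (Real.exp_le_exp.2 (neg_le_neg this)).trans (le_of_eq ?_)
    rw [Real.exp_neg, Real.exp_log (by positivity), inv_div]
  let Z : Set Ω := {ω | ∃ j, F (α0 (tok j ω)) (suc j ω) = 0}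
  have hZ : μ.real Z = 0 := by
    have : μ Z = 0 := by
      have hsub : Z ⊆ ⋃ j : Fin N', ⋃ u : U, ⋃ k : Fin T,
          (if F (α0 u) k = 0 then {ω | tok j ω = u ∧ suc j ω = k} else ∅) := by
        rintro ω ⟨j, hj⟩
        simp only [Set.mem_iUnion]
        refine ⟨j, tok j ω, suc j ω, ?_⟩
        rw [if_pos hj]
        exact ⟨rfl, rfl⟩
      refine measure_mono_null hsub ?_
      simp only [measure_iUnion_null_iff]
      intro j u k
      split_ifs with h
      · rw [hjoint, h]; simp
      · simp
    rw [measureReal_def, this]; simp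
  have hsub : {ω | ¬ ∀ u : U, KLdiv (F (α0 u)) (F (αhat u ω)) ≤ ε + 2 * t} ⊆
      Z ∪ ⋃ u ∈ (Finset.univ : Finset U), (C u ∪ (D 1 u (α0 u) ∪ ⋃ b ∈ P u, D (-1) u b)) := by
    intro ω hω
    by_contra hbad
    apply hω
    intro u
    simp only [Set.mem_union, Set.mem_iUnion, not_or, not_exists, Finset.mem_univ] at hbad
    obtain ⟨hnZ, hbad⟩ := hbad
    obtain ⟨hnC, hnD0, hnD⟩ := hbad u trivial
    have hcn : n0 < cnt u ω := not_le.1 hnC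
    have hcpos : 0 < cnt u ω := hn0pos.trans hcn
    have hsumD : ∀ a, ∑ j ∈ Finset.univ.filter (fun j => tok j ω = u),
          (-Real.log (F a (suc j ω)) - pop u a) = emp u a ω - cnt u ω * pop u a := by
      intro a
      rw [Finset.sum_sub_distrib, Finset.sum_const, nsmul_eq_mul]
    have hfe := hαhat_mem u ω
    have hf0 : α0 u ∈ feas u := ⟨hα0 u, fun k hk => hFc _ k hk⟩
    obtain ⟨b, hbP, hbη⟩ := hP3 u (αhat u ω) hfe
    have hbf := hP1 u b hbP
    have hE0 : emp u (α0 u) ω - cnt u ω * pop u (α0 u) < cnt u ω * t := by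
      have : ¬ (n0 ≤ cnt u ω ∧ cnt u ω * t ≤ 1 * _) := hnD0
      rw [hsumD] at this
      by_contra hh
      exact this ⟨hcn.le, by linarith⟩
    have hE1 : cnt u ω * pop u b - emp u b ω < cnt u ω * t := by
      have : ¬ (n0 ≤ cnt u ω ∧ cnt u ω * t ≤ (-1) * _) := hnD b hbP
      rw [hsumD] at this
      by_contra hh
      exact this ⟨hcn.le, by linarith⟩
    have happ : ∀ k, 0 < F (α0 u) k →
        |F (αhat u ω) k - F b k| / c ≤ ε / 2 := by
      intro k hk
      rw [← hLση]
      gcongr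
      refine (hLip _ _ k).trans ?_
      gcongr
    have happ1 : ∀ k, 0 < F (α0 u) k →
        -Real.log (F (αhat u ω) k) ≤ -Real.log (F b k) + ε / 2 := by
      intro k hk
      have h1 := aux_log hc0 (hbf.2 k hk) (hfe.2 k hk)
      rw [abs_sub_comm] at h1
      linarith [happ k hk]
    have happ2 : ∀ k, 0 < F (α0 u) k →
        -Real.log (F b k) ≤ -Real.log (F (αhat u ω) k) + ε / 2 := by
      intro k hk
      have h1 := aux_log hc0 (hfe.2 k hk) (hbf.2 k hk)
      linarith [happ k hk]
    have hpop : pop u (αhat u ω) ≤ pop u b + ε / 2 := by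
      have : pop u b + ε / 2 = ∑ k, F (α0 u) k * (-Real.log (F b k) + ε / 2) := by
        simp only [mul_add, Finset.sum_add_distrib, ← Finset.sum_mul, hprob, pop]
        ring
      rw [this]
      refine Finset.sum_le_sum fun k _ => ?_
      rcases (hF0 (α0 u) k).eq_or_lt with h | h
      · rw [← h]; simp
      · exact mul_le_mul_of_nonneg_left (happ1 k h) h.le
    have hemp : emp u b ω ≤ emp u (αhat u ω) ω + cnt u ω * (ε / 2) := by
      have : emp u (αhat u ω) ω + cnt u ω * (ε / 2) =
          ∑ j ∈ Finset.univ.filter (fun j => tok j ω = u),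
            (-Real.log (F (αhat u ω) (suc j ω)) + ε / 2) := by
        rw [Finset.sum_add_distrib, Finset.sum_const, nsmul_eq_mul]
      rw [this]
      refine Finset.sum_le_sum fun j hj => ?_
      apply happ2
      have hj' : tok j ω = u := (Finset.mem_filter.1 hj).2
      rw [← hj']
      refine lt_of_le_of_ne (hF0 _ _) (fun h => hnZ ⟨j, h.symm⟩)
    have hmin : emp u (αhat u ω) ω ≤ emp u (α0 u) ω := hαhat_min u ω _ hf0
    rw [aux_KL _ _ (hF0 _) (fun k hk => hc0.trans_le (hfe.2 k hk))]
    change pop u (αhat u ω) - pop u (α0 u) ≤ ε + 2 * t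
    have hfin : cnt u ω * (pop u (αhat u ω) - pop u (α0 u)) ≤ cnt u ω * (ε + 2 * t) := by
      have := mul_le_mul_of_nonneg_left hpop hcpos.le
      linarith
    exact le_of_mul_le_mul_left hfin hcpos
  refine (measureReal_mono hsub).trans ((measureReal_union_le _ _).trans ?_)
  rw [hZ, zero_add]
  refine (measureReal_biUnion_finset_le _ _).trans ?_
  have hone : ∀ u, μ.real (C u ∪ (D 1 u (α0 u) ∪ ⋃ b ∈ P u, D (-1) u b)) ≤ δ / m := by
    intro u
    have hWs : 1 ≤ W ^ s := one_le_pow₀ hW1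
    have hx : 0 ≤ δ / (4 * m * W ^ s) := by positivity
    have h1 : μ.real (⋃ b ∈ P u, D (-1) u b) ≤ W ^ s * (δ / (4 * m * W ^ s)) := by
      refine (measureReal_biUnion_finset_le _ _).trans ?_
      refine (Finset.sum_le_sum fun b _ => hD (-1) u b (by norm_num)).trans ?_
      rw [Finset.sum_const, nsmul_eq_mul]
      exact mul_le_mul_of_nonneg_right (hP2 u) hx
    have h2 := hD 1 u (α0 u) (by norm_num)
    have h3 : δ / (4 * m * W ^ s) ≤ W ^ s * (δ / (4 * m * W ^ s)) := by nlinarith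
    have h4 : W ^ s * (δ / (4 * m * W ^ s)) = δ / (4 * m) := by field_simp
    have h5 : δ / m = δ / (2 * m) + (δ / (4 * m) + δ / (4 * m)) := by field_simp; norm_num
    rw [h5]
    refine (measureReal_union_le _ _).trans (add_le_add (hC u) ?_)
    refine (measureReal_union_le _ _).trans ?_
    linarith
  refine (Finset.sum_le_sum fun u _ => hone u).trans ?_
  rw [Finset.sum_const, Finset.card_univ, hcard, nsmul_eq_mul]
  apply le_of_eq
  field_simp

theorem aux_min (A b K D1 s : ℝ) (hA : 0 < A) (hb : 0 ≤ b) (hK : 0 < K) (hD : 0 < D1)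
    (hs : 1 ≤ s) :
    ∃ ε0, 0 < ε0 ∧ ε0 ≤ D1 ∧ ∀ ε, 0 < ε → D1 ≤ ε + Real.sqrt (A * (s * Real.log (K / ε) + b)) ∨
      ε0 + Real.sqrt (A * (s * Real.log (K / ε0) + b))
        ≤ ε + Real.sqrt (A * (s * Real.log (K / ε) + b)) := by
  set a0 : ℝ := min D1 (K * Real.exp (-(D1 ^ 2 / A))) with ha0
  have ha0pos : 0 < a0 := lt_min hD (by positivity)
  obtain ⟨ε0, hmem, hmin⟩ := (isCompact_Icc (a := a0) (b := D1)).exists_isMinOn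
    ⟨D1, min_le_left _ _, le_rfl⟩
    (f := fun ε => ε + Real.sqrt (A * (s * Real.log (K / ε) + b))) (by
      apply ContinuousOn.add continuousOn_id
      apply ContinuousOn.sqrt
      apply ContinuousOn.mul continuousOn_const
      apply ContinuousOn.add _ continuousOn_const
      apply ContinuousOn.mul continuousOn_const
      apply ContinuousOn.log
      · apply ContinuousOn.div continuousOn_const continuousOn_id
        intro x hx
        exact (ha0pos.trans_le hx.1).ne'
      · intro x hx
        have := ha0pos.trans_le hx.1
        positivity)
  refine ⟨ε0, ha0pos.trans_le hmem.1, hmem.2, fun ε hε => ?_⟩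
  by_cases h1 : D1 ≤ ε
  · left
    have := Real.sqrt_nonneg (A * (s * Real.log (K / ε) + b))
    linarith
  by_cases h2 : a0 ≤ ε
  · right
    exact hmin ⟨h2, (not_le.1 h1).le⟩
  · left
    have h3 : ε ≤ K * Real.exp (-(D1 ^ 2 / A)) := (not_le.1 h2).le.trans (min_le_right _ _)
    have h4 : D1 ^ 2 / A ≤ Real.log (K / ε) := by
      rw [Real.le_log_iff_exp_le (by positivity), le_div_iff₀ hε]
      rw [Real.exp_neg, ← div_eq_mul_inv, le_div_iff₀ (Real.exp_pos _)] at h3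
      linarith
    have h5 : D1 ≤ Real.sqrt (A * (s * Real.log (K / ε) + b)) := by
      apply Real.le_sqrt_of_sq_le
      rw [div_le_iff₀ hA] at h4
      have h6 : 0 ≤ Real.log (K / ε) * A := le_trans (sq_nonneg D1) h4
      have h7 := mul_nonneg hA.le hb
      nlinarith
    linarith

theorem aux_l2 {T : ℕ} (B : ℝ) (a b : Fin T → ℝ) (ha : Real.sqrt (∑ k, (a k) ^ 2) ≤ B)
    (hb : Real.sqrt (∑ k, (b k) ^ 2) ≤ B) : Real.sqrt (∑ k, (a k - b k) ^ 2) ≤ 2 * B := by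
  have h := norm_sub_le (WithLp.toLp 2 a : EuclideanSpace ℝ (Fin T)) (WithLp.toLp 2 b)
  simp only [EuclideanSpace.norm_eq, Real.norm_eq_abs, sq_abs, PiLp.sub_apply] at h
  linarith

/-- Theorem 3.2 (sparse combination, explicit-constant form): under the data model in
which each of `N' ≥ N` i.i.d. occurrences consists of a token drawn uniformly from a set
`U` of `m` new tokens together with a successor drawn from `q^(u) = f(Eᵀα^(u))` with
`α^(u)` `s`-sparse of norm at most `B`, if `N ≥ 8 m log(2m/δ)`, then with probability at
least `1 − δ`, for every `ε > 0` and every `u ∈ U`, the empirical-NLL minimizers `α̂^(u)`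
over the feasible sparse set satisfy
`D(q^(u)‖f(Eᵀα̂^(u))) ≤ ε + sqrt((4 m (log c)²/N)(s log(36BTLσ/(csε)) + log(4m/δ)))`. -/
theorem stmt_12
    {Ω : Type*} [MeasurableSpace Ω] (μ : Measure Ω) [IsProbabilityMeasure μ]
    {T d : ℕ} (E : Matrix (Fin T) (Fin d) ℝ) (σ : ℝ)
    (hσ : ∀ α : Fin T → ℝ,
      Real.sqrt (∑ j, (E.transpose.mulVec α j) ^ 2) ≤ σ * Real.sqrt (∑ k, (α k) ^ 2))
    (c : ℝ) (hc0 : 0 < c) (hc1 : c < 1) (δ : ℝ) (hδ0 : 0 < δ) (hδ1 : δ < 1)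
    (L : ℝ) (hL : 0 < L) (B : ℝ) (hB : 0 < B)
    (s : ℕ) (hs1 : 1 ≤ s) (hsT : s ≤ T) (hd : 1 ≤ d)
    (f : (Fin d → ℝ) → Fin T → ℝ)
    (hLip : ∀ x y : Fin d → ℝ, ∑ k, |f x k - f y k| ≤ L * Real.sqrt (∑ j, (x j - y j) ^ 2))
    (hrange : ∀ x k, f x k = 0 ∨ (c ≤ f x k ∧ f x k ≤ 1))
    (hfprob : ∀ α : Fin T → ℝ, ∑ k, f (E.transpose.mulVec α) k = 1)
    {U : Type*} [Fintype U] [DecidableEq U] [MeasurableSpace U] [MeasurableSingletonClass U]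
    (m : ℕ) (hm : 1 ≤ m) (hcard : Fintype.card U = m)
    (α0 : U → Fin T → ℝ) (hα0 : ∀ u, α0 u ∈ sparseBall T s B)
    (N N' : ℕ) (hNN' : N ≤ N')
    (tok : Fin N' → Ω → U) (suc : Fin N' → Ω → Fin T)
    (hmeas : ∀ j, Measurable fun ω => (tok j ω, suc j ω))
    (hindep : iIndepFun (fun j ω => (tok j ω, suc j ω)) μ)
    (hjoint : ∀ (j : Fin N') (u : U) (k : Fin T),
      μ {ω | tok j ω = u ∧ suc j ω = k}
        = ENNReal.ofReal ((1 / m) * f (E.transpose.mulVec (α0 u)) k))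
    (αhat : U → Ω → Fin T → ℝ)
    (hαhat_mem : ∀ (u : U) (ω : Ω), αhat u ω ∈ {a ∈ sparseBall T s B |
      ∀ k, 0 < f (E.transpose.mulVec (α0 u)) k → c ≤ f (E.transpose.mulVec a) k})
    (hαhat_min : ∀ (u : U) (ω : Ω), ∀ α ∈ {a ∈ sparseBall T s B |
        ∀ k, 0 < f (E.transpose.mulVec (α0 u)) k → c ≤ f (E.transpose.mulVec a) k},
      ∑ j ∈ Finset.univ.filter fun j => tok j ω = u,
          -Real.log (f (E.transpose.mulVec (αhat u ω)) (suc j ω))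
        ≤ ∑ j ∈ Finset.univ.filter fun j => tok j ω = u,
            -Real.log (f (E.transpose.mulVec α) (suc j ω)))
    (hN : 8 * m * Real.log (2 * m / δ) ≤ N) :
    1 - δ ≤ (μ {ω | ∀ ε : ℝ, 0 < ε → ∀ u : U,
        KLdiv (f (E.transpose.mulVec (α0 u))) (f (E.transpose.mulVec (αhat u ω)))
          ≤ ε + Real.sqrt ((4 * m * (Real.log c) ^ 2 / N)
              * (s * Real.log (36 * B * T * L * σ / (c * s * ε))
                  + Real.log (4 * m / δ)))}).toReal := by
  classical
  have hm' : (1 : ℝ) ≤ m := by exact_mod_cast hm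
  have hs' : (1 : ℝ) ≤ s := by exact_mod_cast hs1
  have hsT' : (s : ℝ) ≤ T := by exact_mod_cast hsT
  have hT' : (1 : ℝ) ≤ T := hs'.trans hsT'
  have hlog2 : 0 < Real.log (2 * m / δ) := by
    apply Real.log_pos
    rw [lt_div_iff₀ hδ0]; linarith
  have hNpos : (0 : ℝ) < N := lt_of_lt_of_le (by positivity) hN
  have hσ0 : 0 ≤ σ := by
    have h1 := (Real.sqrt_nonneg _).trans (hσ (fun _ => 1))
    have h2 : 0 < Real.sqrt (∑ k : Fin T, ((fun _ => 1 : Fin T → ℝ) k) ^ 2) := by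
      apply Real.sqrt_pos.2
      simp
      omega
    by_contra hneg
    nlinarith [not_le.1 hneg]
  have hLip' : ∀ (a b : Fin T → ℝ) k,
      |f (E.transpose.mulVec a) k - f (E.transpose.mulVec b) k|
        ≤ L * σ * Real.sqrt (∑ j, (a j - b j) ^ 2) := by
    intro a b k
    have h1 := Finset.single_le_sum
      (f := fun k => |f (E.transpose.mulVec a) k - f (E.transpose.mulVec b) k|)
      (fun _ _ => abs_nonneg _) (Finset.mem_univ k)
    refine h1.trans ((hLip _ _).trans ?_)
    rw [mul_assoc]
    apply mul_le_mul_of_nonneg_left _ hL.le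
    have h2 := hσ (a - b)
    rw [Matrix.mulVec_sub] at h2
    simpa using h2
  have hdet : ∀ ω u, KLdiv (f (E.transpose.mulVec (α0 u))) (f (E.transpose.mulVec (αhat u ω)))
      ≤ 2 * L * σ * B / c := by
    intro ω u
    have hfe := hαhat_mem u ω
    have hF0 : ∀ k, 0 ≤ f (E.transpose.mulVec (α0 u)) k := by
      intro k
      rcases hrange (E.transpose.mulVec (α0 u)) k with h | h
      · exact h.ge
      · exact hc0.le.trans h.1
    rw [aux_KL _ _ hF0 (fun k hk => hc0.trans_le (hfe.2 k hk)), ← Finset.sum_sub_distrib]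
    have : 2 * L * σ * B / c = ∑ k, f (E.transpose.mulVec (α0 u)) k * (2 * L * σ * B / c) := by
      rw [← Finset.sum_mul, hfprob, one_mul]
    rw [this]
    refine Finset.sum_le_sum fun k _ => ?_
    rw [← mul_sub]
    rcases (hF0 k).eq_or_lt with h | h
    · rw [← h]; simp
    · apply mul_le_mul_of_nonneg_left _ h.le
      have hq : c ≤ f (E.transpose.mulVec (α0 u)) k := by
        rcases hrange (E.transpose.mulVec (α0 u)) k with h' | h'
        · exact absurd h' h.ne'
        · exact h'.1
      have h1 := aux_log hc0 hq (hfe.2 k h)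
      have h2 := hLip' (α0 u) (αhat u ω) k
      have h3 := aux_l2 B (α0 u) (αhat u ω) (hα0 u).2 hfe.1.2
      have h4 : |f (E.transpose.mulVec (α0 u)) k - f (E.transpose.mulVec (αhat u ω)) k| / c
          ≤ 2 * L * σ * B / c := by
        apply div_le_div_of_nonneg_right _ hc0.le
        have := mul_le_mul_of_nonneg_left h3 (mul_nonneg hL.le hσ0)
        linarith
      linarith
  rw [← measureReal_def]
  set S : Set Ω := {ω | ∀ ε : ℝ, 0 < ε → ∀ u : U,
        KLdiv (f (E.transpose.mulVec (α0 u))) (f (E.transpose.mulVec (αhat u ω)))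
          ≤ ε + Real.sqrt ((4 * m * (Real.log c) ^ 2 / N)
              * (s * Real.log (36 * B * T * L * σ / (c * s * ε))
                  + Real.log (4 * m / δ)))} with hS
  have hfinal : μ.real Sᶜ ≤ δ → 1 - δ ≤ μ.real S := by
    intro h
    have h1 := measureReal_union_le (μ := μ) S Sᶜ
    rw [Set.union_compl_self, probReal_univ] at h1
    linarith
  apply hfinal
  rcases hσ0.eq_or_lt with h0 | hσpos
  · have : Sᶜ = ∅ := by
      rw [Set.compl_empty_iff, Set.eq_univ_iff_forall]
      intro ω ε hε u
      have h1 := hdet ω u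
      rw [← h0] at h1
      simp only [mul_zero, zero_mul, zero_div] at h1
      have h2 := Real.sqrt_nonneg ((4 * m * (Real.log c) ^ 2 / N)
              * (s * Real.log (36 * B * T * L * σ / (c * s * ε))
                  + Real.log (4 * m / δ)))
      linarith
    rw [this]
    simp [hδ0.le]
  · have hlogc : Real.log c ≠ 0 := (Real.log_neg hc0 hc1).ne
    have hb : 0 ≤ Real.log (4 * m / δ) := by
      apply Real.log_nonneg
      rw [le_div_iff₀ hδ0]; linarith
    have hlc : 0 < Real.log c ^ 2 := by positivity
    obtain ⟨ε0, hε0, hε01, hmin⟩ := aux_min (4 * m * (Real.log c) ^ 2 / N) (Real.log (4 * m / δ))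
      (36 * B * T * L * σ / (c * s)) (2 * L * σ * B / c) s (by positivity) hb (by positivity)
      (by positivity) hs'
    have hcore := aux_core μ c hc0 hc1 δ hδ0 hδ1 L hL σ hσpos B hB s hs1 hsT
      (fun a => f (E.transpose.mulVec a)) hLip' (fun a => hrange _) hfprob m hm hcard α0 hα0 N N' hNN'
      tok suc hmeas hindep hjoint αhat hαhat_mem hαhat_min hN ε0 hε0 hε01
    refine (measureReal_mono ?_).trans hcore
    intro ω hω hgood
    apply hω
    intro ε hε u
    rcases hmin ε hε with h | h
    · rw [div_div] at h
      exact (hdet ω u).trans h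
    · rw [div_div, div_div] at h
      exact (hgood u).trans h
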